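/- There exists a continuous surjective map from the unit interval [0,1] onto the unit square [0,1] × [0,1] (existence of a Peano space-filling curve). -/

import Mathlib

/-- Existence of a Peano space-filling curve: a continuous surjection from `[0,1]` onto `[0,1]²`. -/
theorem exists_space_filling_curve :
    ∃ f : Set.Icc (0:ℝ) 1 → Set.Icc (0:ℝ) 1 × Set.Icc (0:ℝ) 1,
      Continuous f ∧ Function.Surjective f := by
  obtain ⟨g, hg, hgs⟩ := exists_nat_bool_continuous_surjective_of_compact
    (Set.Icc (0:ℝ) 1 × Set.Icc (0:ℝ) 1)
  have hι : Topology.IsClosedEmbedding (Set.inclusion cantorSet_subset_unitInterval) :=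
    have := isCompact_iff_compactSpace.mp isCompact_cantorSet
    (continuous_inclusion _).isClosedEmbedding (Set.inclusion_injective _)
  obtain ⟨F, hF⟩ := ContinuousMap.exists_extension hι
    ⟨g ∘ cantorSetHomeomorphNatToBool, hg.comp cantorSetHomeomorphNatToBool.continuous⟩
  refine ⟨F, F.continuous, fun y => ?_⟩
  obtain ⟨c, rfl⟩ := hgs y
  exact ⟨Set.inclusion cantorSet_subset_unitInterval (cantorSetHomeomorphNatToBool.symm c), by
    simpa using DFunLike.congr_fun hF (cantorSetHomeomorphNatToBool.symm c)⟩
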